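/- The magma with carrier (Fin 5 → ZMod 2) and operation defined coordinatewise by (x ⋄ y)(i) = 1 − x(i+1)·y(i−1), with indices taken modulo 5, satisfies Equation1485 but does not satisfy Equation151. In particular Equation1485 does not imply Equation151, even for finite magmas. (Twisting-semigroup construction applied to the NAND magma on 𝔽₂.) -/

import Mathlib

/-- The twisted NAND operation on `Fin 5 → ZMod 2`:
`(x ⋄ y) i = 1 - x (i+1) * y (i-1)`, with indices modulo 5. -/
def twistedNand (x y : Fin 5 → ZMod 2) : Fin 5 → ZMod 2 :=
  fun i => 1 - x (i + 1) * y (i - 1)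

theorem twistedNand_pt : ∀ a b c : ZMod 2, a = 1 - (1 - b * a) * (1 - a * (1 - c * b)) := by
  decide

theorem twistedNand_sat (x y z : Fin 5 → ZMod 2) :
    x = twistedNand (twistedNand y x) (twistedNand x (twistedNand z y)) := by
  funext i
  have h1 : i + 1 - 1 = i := by revert i; decide
  have h2 : i - 1 + 1 = i := by revert i; decide
  have h3 : i - 1 - 1 - 1 = i + 1 + 1 := by revert i; decide
  simp only [twistedNand, h1, h2, h3]
  exact twistedNand_pt _ _ _

theorem twistedNand_not :
    ¬ (∀ x : Fin 5 → ZMod 2, x = twistedNand (twistedNand x x) (twistedNand x x)) := by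
  intro h
  have := congrFun (h ![1, 0, 0, 0, 0]) 0
  revert this
  decide

/-- The magma `(Fin 5 → ZMod 2, twistedNand)` satisfies Equation1485
(`∀ x y z, x = (y ⋄ x) ⋄ (x ⋄ (z ⋄ y))`) but not Equation151
(`∀ x, x = (x ⋄ x) ⋄ (x ⋄ x)`). In particular Equation1485 does not imply
Equation151, even for finite magmas. -/
theorem twistedNand_Equation1485_not_Equation151 :
    ((∀ x y z : Fin 5 → ZMod 2,
        x = twistedNand (twistedNand y x) (twistedNand x (twistedNand z y))) ∧
      ¬ (∀ x : Fin 5 → ZMod 2, x = twistedNand (twistedNand x x) (twistedNand x x))) ∧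
    ∃ (M : Type) (op : M → M → M), Finite M ∧
      (∀ x y z : M, x = op (op y x) (op x (op z y))) ∧
      ¬ (∀ x : M, x = op (op x x) (op x x)) := by
  exact ⟨⟨twistedNand_sat, twistedNand_not⟩,
    Fin 5 → ZMod 2, twistedNand, inferInstance, twistedNand_sat, twistedNand_not⟩
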